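/- arXiv:1207.5123 — 4 statements merged into one kernel-verified Lean document; each statement's English description precedes it below -/
import Mathlib

section
/- Let K ⊆ ℝ^N be a closed convex pointed cone with nonempty interior, let M be a finite set of real N×N matrices each of which maps K into K, and let U ⊆ K be a bounded set whose convex hull meets the interior of K. Then the joint spectral radius of M satisfies ρ̂(M) ≤ sup over u ∈ U and A ∈ M of |A u|_U, where |x|_U = inf{λ > 0 : x ∈ λ · coni(U)}. -/
open Matrix Filter
open scoped Pointwise

attribute [local instance] Matrix.frobeniusNormedAddCommGroup

/-- Products of length `k` of matrices from `M`. -/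
def prodsLen {N : ℕ} (M : Set (Matrix (Fin N) (Fin N) ℝ)) (k : ℕ) :
    Set (Matrix (Fin N) (Fin N) ℝ) :=
  {P | ∃ l : List (Matrix (Fin N) (Fin N) ℝ),
      l.length = k ∧ (∀ A ∈ l, A ∈ M) ∧ P = l.prod}

/-- Joint spectral radius of a set of matrices. -/
noncomputable def jsr {N : ℕ} (M : Set (Matrix (Fin N) (Fin N) ℝ)) : ℝ :=
  limsup (fun k : ℕ => sSup ((fun P => ‖P‖ ^ ((1:ℝ)/k)) '' prodsLen M k)) atTop

/-- The conical convex hull of `U` with respect to the cone `K`: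
`coni(U) = {x ∈ K : ∃ y ∈ conv(U), y - x ∈ K}`. -/
def coniHull {N : ℕ} (K U : Set (Fin N → ℝ)) : Set (Fin N → ℝ) :=
  {x | x ∈ K ∧ ∃ y ∈ convexHull ℝ U, y - x ∈ K}

/-- `|x|_U = inf {l > 0 : x ∈ l • coni(U)}`. -/
noncomputable def coniNorm {N : ℕ} (K U : Set (Fin N → ℝ)) (x : Fin N → ℝ) : ℝ :=
  sInf {l : ℝ | 0 < l ∧ x ∈ l • coniHull K U}

section ConeLemmas

variable {N : ℕ} {K U : Set (Fin N → ℝ)}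

theorem cone_add_mem (hKconvex : Convex ℝ K)
    (hKcone : ∀ c : ℝ, 0 ≤ c → ∀ x ∈ K, c • x ∈ K) {x y : Fin N → ℝ}
    (hx : x ∈ K) (hy : y ∈ K) : x + y ∈ K := by
  have h := hKcone 2 (by norm_num) _
    (hKconvex hx hy (a := 1 / 2) (b := 1 / 2) (by norm_num) (by norm_num) (by norm_num))
  convert h using 1
  module

/-- Closed pointed cones are normal: order intervals are bounded linearly. -/
theorem exists_norm_le_of_sub_mem_cone (hKclosed : IsClosed K)
    (hKcone : ∀ c : ℝ, 0 ≤ c → ∀ x ∈ K, c • x ∈ K) (hKpointed : K ∩ (-K) ⊆ {0}) :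
    ∃ c : ℝ, 0 < c ∧ ∀ x ∈ K, ∀ y, y - x ∈ K → ‖x‖ ≤ c * ‖y‖ := by
  have hcomp : IsCompact (Metric.sphere (0 : Fin N → ℝ) 1 ∩ K) :=
    (isCompact_sphere _ _).inter_right hKclosed
  have hdisj : Disjoint (Metric.sphere (0 : Fin N → ℝ) 1 ∩ K) (-K) := by
    rw [Set.disjoint_left]
    rintro x ⟨hx1, hxK⟩ hxK'
    have h0 : x = 0 := hKpointed ⟨hxK, hxK'⟩
    simp [h0] at hx1
  obtain ⟨r, hr, h⟩ := Metric.exists_pos_forall_lt_edist hcomp hKclosed.neg hdisj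
  have hr' : (0 : ℝ) < r := hr
  refine ⟨(r : ℝ)⁻¹, by positivity, fun x hx y hy => ?_⟩
  rcases eq_or_ne x 0 with rfl | hx0
  · simp only [norm_zero]; positivity
  have hn : 0 < ‖x‖ := norm_pos_iff.2 hx0
  have hd := h (‖x‖⁻¹ • x) ⟨by simp [norm_smul, hn.ne'], hKcone _ (by positivity) x hx⟩
    (‖x‖⁻¹ • (x - y)) (by
      rw [Set.mem_neg, ← smul_neg, neg_sub]
      exact hKcone _ (by positivity) _ hy)
  rw [edist_nndist, ENNReal.coe_lt_coe, ← NNReal.coe_lt_coe, coe_nndist, dist_eq_norm,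
    ← smul_sub, sub_sub_cancel, norm_smul, norm_inv, norm_norm, inv_mul_eq_div,
    lt_div_iff₀ hn] at hd
  rw [inv_mul_eq_div, le_div_iff₀ hr', mul_comm]
  exact hd.le

theorem convex_coniHull (hKconvex : Convex ℝ K) : Convex ℝ (coniHull K U) := by
  rintro x ⟨hx, x', hx', hxx⟩ y ⟨hy, y', hy', hyy⟩ a b ha hb hab
  refine ⟨hKconvex hx hy ha hb hab, _, convex_convexHull ℝ U hx' hy' ha hb hab, ?_⟩
  convert hKconvex hxx hyy ha hb hab using 1
  module

theorem smul_mem_coniHull (hKconvex : Convex ℝ K)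
    (hKcone : ∀ c : ℝ, 0 ≤ c → ∀ x ∈ K, c • x ∈ K) {x : Fin N → ℝ} (hx : x ∈ coniHull K U)
    {t : ℝ} (ht0 : 0 ≤ t) (ht1 : t ≤ 1) : t • x ∈ coniHull K U := by
  obtain ⟨hxK, y, hy, hyx⟩ := hx
  refine ⟨hKcone t ht0 x hxK, y, hy, ?_⟩
  convert cone_add_mem hKconvex hKcone hyx (hKcone (1 - t) (by linarith) x hxK) using 1
  module

theorem coniNorm_nonneg (x : Fin N → ℝ) : 0 ≤ coniNorm K U x :=
  Real.sInf_nonneg fun _ hl => hl.1.le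

theorem exists_closedBall_subset {y : Fin N → ℝ} (hy : y ∈ interior K) :
    ∃ r : ℝ, 0 < r ∧ ∀ e : Fin N → ℝ, ‖e‖ ≤ r → y + e ∈ K := by
  obtain ⟨r, hr, h⟩ := Metric.nhds_basis_closedBall.mem_iff.1 (mem_interior_iff_mem_nhds.1 hy)
  exact ⟨r, hr, fun e he => h (by simpa [dist_eq_norm] using he)⟩

/-- The gauge of the conical hull absorbs the cone, uniformly on bounded sets. -/
theorem exists_mem_smul_coniHull
    (hKcone : ∀ c : ℝ, 0 ≤ c → ∀ x ∈ K, c • x ∈ K)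
    (hUint : (convexHull ℝ U ∩ interior K).Nonempty) (R : ℝ) :
    ∃ l : ℝ, 0 < l ∧ ∀ x ∈ K, ‖x‖ ≤ R → x ∈ l • coniHull K U := by
  obtain ⟨y, hyU, hyK⟩ := hUint
  obtain ⟨r, hr, h⟩ := exists_closedBall_subset hyK
  have hl : 0 < (|R| + 1) / r := by positivity
  refine ⟨_, hl, fun x hx hxR => ?_⟩
  rw [Set.mem_smul_set_iff_inv_smul_mem₀ hl.ne']
  refine ⟨hKcone _ (by positivity) x hx, y, hyU, ?_⟩
  rw [sub_eq_add_neg]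
  refine h _ ?_
  rw [norm_neg, norm_smul, Real.norm_of_nonneg (by positivity), inv_div, div_mul_eq_mul_div,
    div_le_iff₀ (by positivity)]
  gcongr
  linarith [le_abs_self R]

theorem mem_smul_coniHull_of_coniNorm_lt (hKconvex : Convex ℝ K)
    (hKcone : ∀ c : ℝ, 0 ≤ c → ∀ x ∈ K, c • x ∈ K)
    (hUint : (convexHull ℝ U ∩ interior K).Nonempty) {x : Fin N → ℝ} (hx : x ∈ K) {L : ℝ}
    (hL : coniNorm K U x < L) : x ∈ L • coniHull K U := by
  have hne : {l : ℝ | 0 < l ∧ x ∈ l • coniHull K U}.Nonempty := by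
    obtain ⟨l, hl, h⟩ := exists_mem_smul_coniHull hKcone hUint ‖x‖
    exact ⟨l, hl, h x hx le_rfl⟩
  obtain ⟨l, ⟨hl, z, hz, rfl⟩, hlL⟩ := exists_lt_of_csInf_lt hne hL
  have hL0 : 0 < L := hl.trans hlL
  refine ⟨(l / L) • z, smul_mem_coniHull hKconvex hKcone hz (by positivity)
    ((div_le_one hL0).2 hlL.le), ?_⟩
  simp only [smul_smul]
  rw [mul_div_cancel₀ _ hL0.ne']

theorem mulVec_mem_smul_coniHull (hKconvex : Convex ℝ K)
    (hKcone : ∀ c : ℝ, 0 ≤ c → ∀ x ∈ K, c • x ∈ K)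
    {A : Matrix (Fin N) (Fin N) ℝ} (hA : ∀ x ∈ K, A.mulVec x ∈ K) {L : ℝ} (hL : 0 < L)
    (hAU : ∀ u ∈ U, A.mulVec u ∈ L • coniHull K U) {x : Fin N → ℝ} (hx : x ∈ coniHull K U) :
    A.mulVec x ∈ L • coniHull K U := by
  obtain ⟨hxK, y, hy, hyx⟩ := hx
  have hconv : Convex ℝ (A.mulVecLin ⁻¹' (L • coniHull K U)) :=
    ((convex_coniHull hKconvex).smul L).linear_preimage A.mulVecLin
  obtain ⟨z, ⟨-, w, hw, hwz⟩, hzy⟩ : A.mulVec y ∈ L • coniHull K U :=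
    convexHull_min (s := U) (fun u hu => hAU u hu) hconv hy
  simp only at hzy
  rw [Set.mem_smul_set_iff_inv_smul_mem₀ hL.ne']
  refine ⟨hKcone _ (by positivity) _ (hA x hxK), w, hw, ?_⟩
  convert cone_add_mem hKconvex hKcone hwz
    (hKcone L⁻¹ (by positivity) _ (hA _ hyx)) using 1
  rw [Matrix.mulVec_sub, ← hzy, smul_sub, inv_smul_smul₀ hL.ne']
  abel

theorem list_prod_mulVec_mem {M : Set (Matrix (Fin N) (Fin N) ℝ)} {C : Set (Fin N → ℝ)} {L : ℝ}
    (h : ∀ A ∈ M, ∀ x ∈ C, A.mulVec x ∈ L • C) (l : List (Matrix (Fin N) (Fin N) ℝ))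
    (hl : ∀ A ∈ l, A ∈ M) : ∀ x ∈ C, l.prod.mulVec x ∈ L ^ l.length • C := by
  induction l with
  | nil => intro x hx; simpa using hx
  | cons A l ih =>
    intro x hx
    obtain ⟨z, hz, hzx⟩ := ih (fun B hB => hl B (List.mem_cons_of_mem _ hB)) x hx
    obtain ⟨w, hw, hwz⟩ := h A (hl A List.mem_cons_self) z hz
    simp only at hzx hwz
    refine ⟨w, hw, ?_⟩
    simp only [List.prod_cons, List.length_cons, ← Matrix.mulVec_mulVec, ← hzx,
      Matrix.mulVec_smul, ← hwz, smul_smul, pow_succ]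

theorem exists_norm_le_of_mem_coniHull (hKclosed : IsClosed K)
    (hKcone : ∀ c : ℝ, 0 ≤ c → ∀ x ∈ K, c • x ∈ K) (hKpointed : K ∩ (-K) ⊆ {0})
    (hUbd : Bornology.IsBounded U) : ∃ B : ℝ, 0 < B ∧ ∀ x ∈ coniHull K U, ‖x‖ ≤ B := by
  obtain ⟨c, hc, h⟩ := exists_norm_le_of_sub_mem_cone hKclosed hKcone hKpointed
  obtain ⟨R, hR, hUR⟩ := (isBounded_convexHull.2 hUbd).exists_pos_norm_le
  refine ⟨c * R, by positivity, ?_⟩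
  rintro x ⟨hxK, y, hy, hyx⟩
  exact (h x hxK y hyx).trans (by gcongr; exact hUR y hy)

theorem frobenius_norm_le_of_entry_le {P : Matrix (Fin N) (Fin N) ℝ} {c : ℝ} (hc : 0 ≤ c)
    (h : ∀ i j, |P i j| ≤ c) : ‖P‖ ≤ N * c := by
  rw [Matrix.frobenius_norm_def, ← Real.sqrt_eq_rpow]
  refine Real.sqrt_le_iff.2 ⟨by positivity, ?_⟩
  calc ∑ i, ∑ j, ‖P i j‖ ^ (2 : ℝ) ≤ ∑ _i : Fin N, ∑ _j : Fin N, c ^ 2 := by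
        gcongr with i _ j
        rw [Real.rpow_two]
        gcongr
        exact h i j
    _ = (N * c) ^ 2 := by simp; ring

/-- A matrix mapping the conical hull into its `s`-multiple has norm of order `s`. -/
theorem exists_norm_le_of_mapsTo_coniHull (hKclosed : IsClosed K)
    (hKcone : ∀ c : ℝ, 0 ≤ c → ∀ x ∈ K, c • x ∈ K) (hKpointed : K ∩ (-K) ⊆ {0})
    (hUbd : Bornology.IsBounded U) (hUint : (convexHull ℝ U ∩ interior K).Nonempty) :
    ∃ C : ℝ, 0 < C ∧ ∀ (P : Matrix (Fin N) (Fin N) ℝ) (s : ℝ), 0 < s →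
      (∀ x ∈ coniHull K U, P.mulVec x ∈ s • coniHull K U) → ‖P‖ ≤ C * s := by
  obtain ⟨B, hB, hBx⟩ := exists_norm_le_of_mem_coniHull hKclosed hKcone hKpointed hUbd
  obtain ⟨y, hyU, hyK⟩ := hUint
  obtain ⟨r, hr, hball⟩ := exists_closedBall_subset hyK
  refine ⟨N * (r⁻¹ * (2 * (B + B))) + 1, by positivity, fun P s hs hP => ?_⟩
  have hbd : ∀ x ∈ coniHull K U, ‖P.mulVec x‖ ≤ s * B := by
    intro x hx
    obtain ⟨z, hz, hzx⟩ := hP x hx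
    simp only at hzx
    rw [← hzx, norm_smul, Real.norm_of_nonneg hs.le]
    gcongr
    exact hBx z hz
  have hmid : ∀ e : Fin N → ℝ, ‖e‖ ≤ r → (1 / 2 : ℝ) • (y + e) ∈ coniHull K U := by
    intro e he
    refine ⟨hKcone _ (by norm_num) _ (hball e he), y, hyU, ?_⟩
    convert hKcone (1 / 2) (by norm_num) _ (hball (-e) (by rwa [norm_neg])) using 1
    module
  have hentry : ∀ i j, |P i j| ≤ r⁻¹ * (2 * (B + B)) * s := by
    intro i j
    have he : ‖r • (Pi.single j 1 : Fin N → ℝ)‖ ≤ r := by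
      rw [norm_smul, Pi.norm_single, norm_one, mul_one, Real.norm_of_nonneg hr.le]
    have h1 := hbd _ (hmid _ he)
    have h0 := hbd _ (hmid 0 (by simpa using hr.le))
    have hcol : P.col j = (r⁻¹ * 2) • (P.mulVec ((1 / 2 : ℝ) • (y + r • Pi.single j 1)) -
        P.mulVec ((1 / 2 : ℝ) • (y + 0))) := by
      rw [← Matrix.mulVec_sub, ← Matrix.mulVec_smul, ← Matrix.mulVec_single_one]
      congr 1
      rw [← smul_sub, add_sub_add_left_eq_sub, sub_zero, smul_smul, smul_smul,
        show r⁻¹ * 2 * (1 / 2) * r = 1 by field_simp, one_smul]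
    calc |P i j| = ‖P.col j i‖ := rfl
      _ ≤ ‖P.col j‖ := norm_le_pi_norm _ i
      _ ≤ r⁻¹ * 2 * (s * B + s * B) := by
        rw [hcol, norm_smul, Real.norm_of_nonneg (by positivity)]
        gcongr
        exact (norm_sub_le _ _).trans (add_le_add h1 h0)
      _ = r⁻¹ * (2 * (B + B)) * s := by ring
  calc ‖P‖ ≤ _ := frobenius_norm_le_of_entry_le (by positivity) hentry
    _ ≤ _ := by nlinarith

theorem jsr_le_of_norm_le {M : Set (Matrix (Fin N) (Fin N) ℝ)} {C L : ℝ} (hC : 0 < C)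
    (hL : 0 < L) (h : ∀ k, ∀ P ∈ prodsLen M k, ‖P‖ ≤ C * L ^ k) : jsr M ≤ L := by
  have hlim : Tendsto (fun k : ℕ => C ^ ((1 : ℝ) / k) * L) atTop (nhds L) := by
    have h1 : Tendsto (fun k : ℕ => C ^ ((1 : ℝ) / k)) atTop (nhds 1) := by
      simpa using tendsto_const_nhds.rpow (tendsto_one_div_atTop_nhds_zero_nat (𝕜 := ℝ))
        (Or.inl hC.ne')
    simpa using h1.mul_const L
  rw [jsr, ← hlim.limsup_eq]
  refine limsup_le_limsup ?_ ?_ hlim.isBoundedUnder_le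
  · filter_upwards [eventually_gt_atTop 0] with k hk
    refine Real.sSup_le ?_ (by positivity)
    rintro _ ⟨P, hP, rfl⟩
    calc ‖P‖ ^ ((1 : ℝ) / k) ≤ (C * L ^ k) ^ ((1 : ℝ) / k) := by
          gcongr; exact h k P hP
      _ = C ^ ((1 : ℝ) / k) * L := by
          rw [Real.mul_rpow hC.le (by positivity), one_div, Real.pow_rpow_inv_natCast hL.le hk.ne']
  · refine IsBoundedUnder.isCoboundedUnder_le ⟨0, ?_⟩
    refine eventually_map.2 (Eventually.of_forall fun k => Real.sSup_nonneg ?_)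
    rintro _ ⟨P, -, rfl⟩
    positivity

theorem bddAbove_coniNorm_mulVec
    (hKcone : ∀ c : ℝ, 0 ≤ c → ∀ x ∈ K, c • x ∈ K)
    {M : Set (Matrix (Fin N) (Fin N) ℝ)} (hMfin : M.Finite)
    (hMK : ∀ A ∈ M, ∀ x ∈ K, A.mulVec x ∈ K) (hUK : U ⊆ K)
    (hUbd : Bornology.IsBounded U) (hUint : (convexHull ℝ U ∩ interior K).Nonempty) :
    BddAbove {t : ℝ | ∃ u ∈ U, ∃ A ∈ M, t = coniNorm K U (A.mulVec u)} := by
  have hb : Bornology.IsBounded (⋃ A ∈ M, A.mulVec '' U) :=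
    (Bornology.isBounded_biUnion hMfin).2 fun A _ =>
      hUbd.image A.mulVecLin.toContinuousLinearMap
  obtain ⟨R, hR⟩ := hb.exists_norm_le
  obtain ⟨l, hl, h⟩ := exists_mem_smul_coniHull hKcone hUint R
  refine ⟨l, ?_⟩
  rintro _ ⟨u, hu, A, hA, rfl⟩
  exact csInf_le ⟨0, fun _ ht => ht.1.le⟩ ⟨hl, h _ (hMK A hA u (hUK hu))
    (hR _ (Set.mem_biUnion hA (Set.mem_image_of_mem _ hu)))⟩

end ConeLemmas

/-- if all matrices of a finite set `M` leave invariant a closed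
convex pointed cone `K` with nonempty interior, and `U ⊆ K` is bounded with
`conv(U)` meeting the interior of `K`, then
`ρ̂(M) ≤ sup_{u ∈ U, A ∈ M} |A u|_U`. -/
theorem stmt1 {N : ℕ} (K : Set (Fin N → ℝ))
    (hKclosed : IsClosed K) (hKconvex : Convex ℝ K)
    (hKcone : ∀ c : ℝ, 0 ≤ c → ∀ x ∈ K, c • x ∈ K)
    (hKpointed : K ∩ (-K) ⊆ {0})
    (hKint : (interior K).Nonempty)
    (M : Set (Matrix (Fin N) (Fin N) ℝ)) (hMfin : M.Finite) (hMne : M.Nonempty)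
    (hMK : ∀ A ∈ M, ∀ x ∈ K, A.mulVec x ∈ K)
    (U : Set (Fin N → ℝ)) (hUK : U ⊆ K)
    (hUbd : Bornology.IsBounded U)
    (hUint : (convexHull ℝ U ∩ interior K).Nonempty) :
    jsr M ≤ sSup {t : ℝ | ∃ u ∈ U, ∃ A ∈ M, t = coniNorm K U (A.mulVec u)} := by
  refine le_of_forall_gt_imp_ge_of_dense fun L hL => ?_
  have hbdd := bddAbove_coniNorm_mulVec hKcone hMfin hMK hUK hUbd hUint
  have hL0 : 0 < L := by
    refine lt_of_le_of_lt (Real.sSup_nonneg ?_) hL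
    rintro _ ⟨u, -, A, -, rfl⟩
    exact coniNorm_nonneg _
  have hstep : ∀ A ∈ M, ∀ x ∈ coniHull K U, A.mulVec x ∈ L • coniHull K U := fun A hA x hx =>
    mulVec_mem_smul_coniHull hKconvex hKcone (hMK A hA) hL0
      (fun u hu => mem_smul_coniHull_of_coniNorm_lt hKconvex hKcone hUint (hMK A hA u (hUK hu))
        ((le_csSup hbdd ⟨u, hu, A, hA, rfl⟩).trans_lt hL)) hx
  obtain ⟨C, hC, hnorm⟩ :=
    exists_norm_le_of_mapsTo_coniHull hKclosed hKcone hKpointed hUbd hUint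
  refine jsr_le_of_norm_le hC hL0 ?_
  rintro _ P ⟨l, rfl, hl, rfl⟩
  exact hnorm _ _ (pow_pos hL0 _) (list_prod_mulVec_mem hstep l hl)
end

section
/- Let M be a finite set of real n×n matrices, let S denote the multiplicative semigroup consisting of the identity matrix together with all finite products of matrices of M, let v₁, v₂ ∈ ℝ^n be vectors not both zero, and suppose there exists a nonzero vector x ∈ ℝ^n such that xᵀ P (v₁v₁ᵀ + v₂v₂ᵀ) Pᵀ x = 0 for every P ∈ S. Then the linear span W of {P v₁ : P ∈ S} ∪ {P v₂ : P ∈ S} is invariant under every A ∈ M, contains v₁ and v₂ (hence is nonzero), and is contained in the orthogonal complement of x (hence is a proper subspace of ℝ^n). -/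
open Matrix

/-- The multiplicative semigroup with identity generated by `M`: the identity
matrix together with all finite products of matrices of `M`. -/
def prodSemigroup {n : ℕ} (M : Set (Matrix (Fin n) (Fin n) ℝ)) :
    Set (Matrix (Fin n) (Fin n) ℝ) :=
  {P | ∃ l : List (Matrix (Fin n) (Fin n) ℝ), (∀ A ∈ l, A ∈ M) ∧ P = l.prod}

theorem one_mem_prodSemigroup {n : ℕ} (M : Set (Matrix (Fin n) (Fin n) ℝ)) :
    1 ∈ prodSemigroup M :=
  ⟨[], by simp, by simp⟩

theorem mul_mem_prodSemigroup {n : ℕ} {M : Set (Matrix (Fin n) (Fin n) ℝ)}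
    {A P : Matrix (Fin n) (Fin n) ℝ} (hA : A ∈ M) (hP : P ∈ prodSemigroup M) :
    A * P ∈ prodSemigroup M := by
  obtain ⟨l, hl, rfl⟩ := hP
  exact ⟨A :: l, by simpa using ⟨hA, hl⟩, by simp⟩

theorem dotProduct_mul_vecMulVec_mul_transpose_mulVec {n : ℕ}
    (P : Matrix (Fin n) (Fin n) ℝ) (v x : Fin n → ℝ) :
    x ⬝ᵥ (P * vecMulVec v v * Pᵀ) *ᵥ x = (x ⬝ᵥ P *ᵥ v) ^ 2 := by
  rw [mul_vecMulVec, vecMulVec_mul, vecMul_transpose, vecMulVec_mulVec]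
  simp [dotProduct_comm _ x, sq]

/-- if `xᵀ P (v₁v₁ᵀ + v₂v₂ᵀ) Pᵀ x = 0` for every `P` in the
semigroup generated by `M`, with `x ≠ 0` and `v₁, v₂` not both zero, then the
span `W` of the trajectories of `v₁` and `v₂` is invariant under every `A ∈ M`,
contains `v₁` and `v₂` (hence is nonzero), and is contained in the orthogonal
complement of `x` (hence is a proper subspace of `ℝ^n`). -/
theorem stmt3 {n : ℕ} (M : Set (Matrix (Fin n) (Fin n) ℝ)) (hMfin : M.Finite)
    (v₁ v₂ : Fin n → ℝ) (hv : ¬(v₁ = 0 ∧ v₂ = 0))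
    (x : Fin n → ℝ) (hx : x ≠ 0)
    (hzero : ∀ P ∈ prodSemigroup M,
      x ⬝ᵥ (P * (vecMulVec v₁ v₁ + vecMulVec v₂ v₂) * Pᵀ).mulVec x = 0)
    (W : Submodule ℝ (Fin n → ℝ))
    (hW : W = Submodule.span ℝ
      ({w | ∃ P ∈ prodSemigroup M, w = P.mulVec v₁} ∪
       {w | ∃ P ∈ prodSemigroup M, w = P.mulVec v₂})) :
    (∀ A ∈ M, ∀ w ∈ W, A.mulVec w ∈ W) ∧
    v₁ ∈ W ∧ v₂ ∈ W ∧ W ≠ ⊥ ∧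
    (∀ w ∈ W, x ⬝ᵥ w = 0) ∧ W ≠ ⊤ := by
  have horth : ∀ P ∈ prodSemigroup M, x ⬝ᵥ P *ᵥ v₁ = 0 ∧ x ⬝ᵥ P *ᵥ v₂ = 0 := by
    intro P hP
    have h := hzero P hP
    rw [mul_add, add_mul, add_mulVec, dotProduct_add,
      dotProduct_mul_vecMulVec_mul_transpose_mulVec,
      dotProduct_mul_vecMulVec_mul_transpose_mulVec] at h
    constructor <;> nlinarith [sq_nonneg (x ⬝ᵥ P *ᵥ v₁), sq_nonneg (x ⬝ᵥ P *ᵥ v₂)]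
  have hinv : ∀ A ∈ M, ∀ w ∈ W, A *ᵥ w ∈ W := by
    intro A hA w hw
    suffices W ≤ W.comap A.mulVecLin from this hw
    nth_rw 1 [hW]
    rw [Submodule.span_le]
    rintro _ (⟨P, hP, rfl⟩ | ⟨P, hP, rfl⟩)
    all_goals
      simp only [SetLike.mem_coe, Submodule.mem_comap, mulVecLin_apply, mulVec_mulVec]
      rw [hW]
      apply Submodule.subset_span
    · exact Or.inl ⟨_, mul_mem_prodSemigroup hA hP, rfl⟩
    · exact Or.inr ⟨_, mul_mem_prodSemigroup hA hP, rfl⟩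
  have hv₁ : v₁ ∈ W := by
    rw [hW]
    exact Submodule.subset_span (Or.inl ⟨1, one_mem_prodSemigroup M, by simp⟩)
  have hv₂ : v₂ ∈ W := by
    rw [hW]
    exact Submodule.subset_span (Or.inr ⟨1, one_mem_prodSemigroup M, by simp⟩)
  have hperp : ∀ w ∈ W, x ⬝ᵥ w = 0 := by
    intro w hw
    rw [hW] at hw
    induction hw using Submodule.span_induction with
    | mem w hw =>
      obtain ⟨P, hP, rfl⟩ | ⟨P, hP, rfl⟩ := hw
      · exact (horth P hP).1
      · exact (horth P hP).2
    | zero => simp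
    | add u w _ _ hu hw => rw [dotProduct_add, hu, hw, add_zero]
    | smul c w _ hw => rw [dotProduct_smul, hw, smul_zero]
  refine ⟨hinv, hv₁, hv₂, ?_, hperp, ?_⟩
  · intro h
    rw [h, Submodule.mem_bot] at hv₁ hv₂
    exact hv ⟨hv₁, hv₂⟩
  · intro h
    exact hx (dotProduct_self_eq_zero.mp (hperp x (h ▸ Submodule.mem_top)))
end

section
/- Let (s_i)_{i∈ℕ} be a sequence of vectors in ℂ^n converging to zero, and for each i let s̃_i = Re(s_i s_i^*), a real symmetric positive semidefinite n×n matrix. Then the conical convex hull (with respect to the PSD cone) of the set {s̃_i : i ∈ ℕ} is a conitope: there exists N such that coni({s̃_i : i ∈ ℕ}) = coni({s̃_i : i ≤ N}). -/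
open Matrix Filter

/-- The semidefinite lifting of a complex vector: `s̃ = Re(s s^*)`, a real
symmetric positive semidefinite matrix. -/
noncomputable def sdLift {n : ℕ} (s : Fin n → ℂ) : Matrix (Fin n) (Fin n) ℝ :=
  Matrix.of fun a b => (s a * (starRingEnd ℂ) (s b)).re

/-- The conical convex hull of a set `U` of matrices with respect to the PSD
cone: `coni(U) = {x PSD : ∃ y ∈ conv(U), y - x PSD}`. -/
def coniPSD {n : ℕ} (U : Set (Matrix (Fin n) (Fin n) ℝ)) :
    Set (Matrix (Fin n) (Fin n) ℝ) :=
  {x | x.PosSemidef ∧ ∃ y ∈ convexHull ℝ U, (y - x).PosSemidef}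

theorem sdLift_isHermitian {n : ℕ} (s : Fin n → ℂ) : (sdLift s).IsHermitian := by
  ext a b
  simp [sdLift, Complex.mul_re]
  ring

theorem dotProduct_sdLift_mulVec {n : ℕ} (s : Fin n → ℂ) (x : Fin n → ℝ) :
    x ⬝ᵥ (sdLift s *ᵥ x) = ‖∑ a, s a * (x a : ℂ)‖ ^ 2 := by
  rw [← Complex.normSq_eq_norm_sq, Complex.normSq_apply]
  simp only [Complex.re_sum, Complex.im_sum, Complex.re_mul_ofReal, Complex.im_mul_ofReal,
    Finset.sum_mul_sum, ← Finset.sum_add_distrib]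
  simp only [dotProduct, mulVec, sdLift, Matrix.of_apply, Finset.mul_sum]
  refine Finset.sum_congr rfl fun a _ => Finset.sum_congr rfl fun b _ => ?_
  simp [Complex.mul_re]
  ring

/-- A complex linear combination with small coefficients has a lifting dominated by the
average of the liftings. -/
theorem posSemidef_average_sub_sdLift {n k : ℕ} (v : Fin k → Fin n → ℂ) (c : Fin k → ℂ)
    (hc : ∑ j, ‖c j‖ ^ 2 ≤ (k : ℝ)⁻¹) :
    ((∑ j, (k : ℝ)⁻¹ • sdLift (v j)) - sdLift (∑ j, c j • v j)).PosSemidef := by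
  refine Matrix.PosSemidef.of_dotProduct_mulVec_nonneg ?_ fun x => ?_
  · refine Matrix.IsHermitian.sub ?_ (sdLift_isHermitian _)
    simp only [Matrix.IsHermitian, Matrix.conjTranspose_sum, Matrix.conjTranspose_smul,
      (sdLift_isHermitian _).eq, star_trivial]
  · have hsum : ∑ a, (∑ j, c j • v j) a * (x a : ℂ) = ∑ j, c j * ∑ a, v j a * (x a : ℂ) := by
      simp only [Finset.sum_apply, Pi.smul_apply, smul_eq_mul, Finset.sum_mul, Finset.mul_sum,
        mul_assoc]
      exact Finset.sum_comm
    simp only [star_trivial, Matrix.sub_mulVec, dotProduct_sub, Matrix.sum_mulVec,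
      dotProduct_sum, Matrix.smul_mulVec, dotProduct_smul, dotProduct_sdLift_mulVec, hsum,
      sub_nonneg, smul_eq_mul, ← Finset.mul_sum]
    have hnorm : ‖∑ j, c j * ∑ a, v j a * (x a : ℂ)‖ ≤
        ∑ j, ‖c j‖ * ‖∑ a, v j a * (x a : ℂ)‖ :=
      (norm_sum_le _ _).trans_eq (by simp only [norm_mul])
    calc _ ≤ (∑ j, ‖c j‖ * ‖∑ a, v j a * (x a : ℂ)‖) ^ 2 := by gcongr
      _ ≤ (∑ j, ‖c j‖ ^ 2) * ∑ j, ‖∑ a, v j a * (x a : ℂ)‖ ^ 2 :=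
        Finset.sum_mul_sq_le_sq_mul_sq _ _ _
      _ ≤ _ := by gcongr

/-- All terms of a sequence in a Noetherian module lie in the span of finitely many of them. -/
theorem exists_forall_mem_span_range_fin {R M : Type*} [Semiring R] [AddCommMonoid M]
    [Module R M] [IsNoetherian R M] (s : ℕ → M) :
    ∃ m : ℕ, ∀ i, s i ∈ Submodule.span R (Set.range fun j : Fin (m + 1) => s j) := by
  let F : ℕ →o Submodule R M :=
    ⟨fun m => Submodule.span R (s '' Set.Iic m), fun a b h =>
      Submodule.span_mono (Set.image_mono (Set.Iic_subset_Iic.2 h))⟩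
  obtain ⟨m, hm⟩ := monotone_stabilizes_iff_noetherian.2 ‹IsNoetherian R M› F
  refine ⟨m, fun i => ?_⟩
  have hmem : s i ∈ F (max m i) :=
    Submodule.subset_span ⟨i, le_max_right m i, rfl⟩
  rw [← hm _ (le_max_left m i)] at hmem
  refine Submodule.span_mono ?_ hmem
  rintro _ ⟨j, hj, rfl⟩
  exact ⟨⟨j, Nat.lt_succ_of_le hj⟩, rfl⟩

/-- A null sequence in the span of a finite family is given by null coefficients. -/
theorem exists_tendsto_zero_coefficients {n k : ℕ} (v : Fin k → Fin n → ℂ)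
    (s : ℕ → Fin n → ℂ) (hs : Tendsto s atTop (nhds 0))
    (hspan : ∀ i, s i ∈ Submodule.span ℂ (Set.range v)) :
    ∃ c : ℕ → Fin k → ℂ, Tendsto c atTop (nhds 0) ∧ ∀ i, s i = ∑ j, c i j • v j := by
  let T := Fintype.linearCombination ℂ v
  have hT : ∀ i, s i ∈ LinearMap.range T := fun i => by
    rw [Fintype.range_linearCombination]
    exact hspan i
  obtain ⟨g, hg⟩ := T.rangeRestrict.exists_rightInverse_of_surjective T.range_rangeRestrict
  refine ⟨fun i => g ⟨s i, hT i⟩, ?_, fun i => ?_⟩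
  · have hg0 : Tendsto g (nhds 0) (nhds 0) := by
      simpa using (LinearMap.continuous_of_finiteDimensional g).tendsto 0
    exact hg0.comp (tendsto_subtype_rng.2 (by simpa using hs))
  · have h := congrArg Subtype.val (LinearMap.congr_fun hg ⟨s i, hT i⟩)
    simpa [T, Fintype.linearCombination_apply] using h.symm

theorem coniPSD_mono {n : ℕ} {U V : Set (Matrix (Fin n) (Fin n) ℝ)} (h : U ⊆ V) :
    coniPSD U ⊆ coniPSD V :=
  fun _ ⟨hx, y, hy, hyx⟩ => ⟨hx, y, convexHull_mono h hy, hyx⟩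

theorem coniPSD_subset_of_dominated {n : ℕ} {U V : Set (Matrix (Fin n) (Fin n) ℝ)}
    (h : ∀ u ∈ U, ∃ y ∈ convexHull ℝ V, (y - u).PosSemidef) : coniPSD U ⊆ coniPSD V := by
  have hconv : Convex ℝ {u : Matrix (Fin n) (Fin n) ℝ |
      ∃ y ∈ convexHull ℝ V, (y - u).PosSemidef} := by
    rintro u ⟨y, hy, hyu⟩ w ⟨z, hz, hzw⟩ a b ha hb hab
    refine ⟨a • y + b • z, convex_convexHull ℝ V hy hz ha hb hab, ?_⟩
    have heq : a • y + b • z - (a • u + b • w) = a • (y - u) + b • (z - w) := by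
      simp only [smul_sub]
      abel
    rw [heq]
    exact (hyu.smul ha).add (hzw.smul hb)
  rintro x ⟨hx, u, hu, hux⟩
  obtain ⟨y, hy, hyu⟩ := convexHull_min h hconv hu
  exact ⟨hx, y, hy, by simpa using hyu.add hux⟩

/-- if a sequence of vectors `s_i ∈ ℂ^n` converges to zero, then
the conical convex hull of the lifted set `{s̃_i}` is a conitope: it equals
the conical convex hull of finitely many of the `s̃_i`. -/
theorem stmt4 {n : ℕ} (s : ℕ → (Fin n → ℂ))
    (hs : Tendsto s atTop (nhds 0)) :
    ∃ N : ℕ, coniPSD {m | ∃ i : ℕ, m = sdLift (s i)} =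
      coniPSD {m | ∃ i ≤ N, m = sdLift (s i)} := by
  obtain ⟨m, hm⟩ := exists_forall_mem_span_range_fin (R := ℂ) s
  obtain ⟨c, hc, hsc⟩ := exists_tendsto_zero_coefficients _ s hs hm
  have hsq : Tendsto (fun i => ∑ j, ‖c i j‖ ^ 2) atTop (nhds 0) := by
    have hcont : Continuous fun d : Fin (m + 1) → ℂ => ∑ j, ‖d j‖ ^ 2 := by fun_prop
    simpa [Function.comp_def] using (hcont.tendsto 0).comp hc
  have hpos : (0 : ℝ) < ((m + 1 : ℕ) : ℝ)⁻¹ := by positivity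
  obtain ⟨M, hM⟩ := eventually_atTop.1 (hsq.eventually_le_const hpos)
  refine ⟨max m M, (coniPSD_subset_of_dominated ?_).antisymm
    (coniPSD_mono fun x ⟨i, _, hi⟩ => ⟨i, hi⟩)⟩
  rintro _ ⟨i, rfl⟩
  rcases le_total i M with hi | hi
  · exact ⟨_, subset_convexHull ℝ _ ⟨i, le_max_of_le_right hi, rfl⟩, by
      simpa using Matrix.PosSemidef.zero⟩
  · refine ⟨∑ j : Fin (m + 1), ((m + 1 : ℕ) : ℝ)⁻¹ • sdLift (s j), ?_, ?_⟩
    · refine (convex_convexHull ℝ _).sum_mem (fun _ _ => hpos.le) ?_ fun j _ =>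
        subset_convexHull ℝ _ ⟨j, le_max_of_le_left (Nat.le_of_lt_succ j.2), rfl⟩
      rw [Finset.sum_const, Finset.card_univ, Fintype.card_fin, nsmul_eq_mul,
        mul_inv_cancel₀ (inv_pos.1 hpos).ne']
    · have h := posSemidef_average_sub_sdLift (fun j : Fin (m + 1) => s j) (c i) (hM i hi)
      rwa [← hsc i] at h
end

section
/- Let K ⊆ ℝ^n be a closed convex pointed cone with nonempty interior and let A be a real n×n matrix with A K ⊆ K. Then the spectral radius ρ(A) is an eigenvalue of A and admits an eigenvector lying in K: there exists v ∈ K, v ≠ 0, with A v = ρ(A) v. -/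
open Matrix

/-- The spectral radius of a real matrix: the maximum modulus of its complex
eigenvalues. -/
noncomputable def specRad {n : ℕ} (P : Matrix (Fin n) (Fin n) ℝ) : ℝ :=
  (spectralRadius ℂ (P.map (algebraMap ℝ ℂ))).toReal

section Gelfand

attribute [local instance] Matrix.linftyOpNormedAddCommGroup Matrix.linftyOpNormedSpace
  Matrix.linftyOpNormedRing Matrix.linftyOpNormedAlgebra

/-- Some complex eigenvalue has modulus equal to the spectral radius. -/
lemma exists_eigenvector_norm_eq_specRad {n : ℕ} (hn : 0 < n) (A : Matrix (Fin n) (Fin n) ℝ) :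
    ∃ (μ : ℂ) (w : Fin n → ℂ), w ≠ 0 ∧ (A.map (algebraMap ℝ ℂ)).mulVec w = μ • w ∧
      ‖μ‖ = specRad A := by
  have : Nonempty (Fin n) := ⟨⟨0, hn⟩⟩
  have : CompleteSpace (Matrix (Fin n) (Fin n) ℂ) := FiniteDimensional.complete ℂ _
  obtain ⟨μ, hμ, hr⟩ := spectrum.exists_nnnorm_eq_spectralRadius (A.map (algebraMap ℝ ℂ))
  rw [← Matrix.spectrum_toLin', ← Module.End.hasEigenvalue_iff_mem_spectrum] at hμ
  obtain ⟨w, hw⟩ := hμ.exists_hasEigenvector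
  refine ⟨μ, w, hw.2, by simpa using hw.apply_eq_smul, ?_⟩
  rw [specRad, ← hr]
  simp

/-- The Neumann series of `A` converges beyond the spectral radius. -/
lemma summable_pow_mulVec_of_specRad_lt {n : ℕ} (hn : 0 < n) (A : Matrix (Fin n) (Fin n) ℝ)
    {r : ℝ} (hr : specRad A < r) (x : Fin n → ℝ) :
    Summable fun k : ℕ => (r⁻¹) ^ (k + 1) • (A ^ k).mulVec x := by
  have : Nonempty (Fin n) := ⟨⟨0, hn⟩⟩
  have : CompleteSpace (Matrix (Fin n) (Fin n) ℂ) := FiniteDimensional.complete ℂ _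
  set B := A.map (algebraMap ℝ ℂ) with hB
  have h0 : 0 ≤ specRad A := ENNReal.toReal_nonneg
  have hr0 : 0 < r := h0.trans_lt hr
  obtain ⟨s, hs, hsr⟩ := exists_between hr
  have hs0 : 0 < s := h0.trans_lt hs
  have hlt : spectralRadius ℂ B < ENNReal.ofReal s := by
    obtain ⟨μ, -, hμ⟩ := spectrum.exists_nnnorm_eq_spectralRadius B
    exact (ENNReal.lt_ofReal_iff_toReal_lt (by simp [← hμ])).2 hs
  have hpow : ∀ᶠ k : ℕ in Filter.atTop, ‖B ^ k‖ ≤ s ^ k := by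
    filter_upwards [(spectrum.pow_norm_pow_one_div_tendsto_nhds_spectralRadius B).eventually_lt_const
      hlt, Filter.eventually_gt_atTop 0] with k hk hk0
    have h1 := (ENNReal.ofReal_lt_ofReal_iff hs0).1 hk
    have h2 := pow_le_pow_left₀ (by positivity) h1.le k
    rwa [one_div, Real.rpow_inv_natCast_pow (norm_nonneg _) hk0.ne'] at h2
  have hsum : Summable fun k : ℕ => ((r⁻¹) ^ (k + 1) : ℝ) • B ^ k := by
    refine Summable.of_norm_bounded_eventually_nat (g := fun k => r⁻¹ * (s / r) ^ k)
      ((summable_geometric_of_lt_one (by positivity) ((div_lt_one hr0).2 hsr)).mul_left _) ?_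
    filter_upwards [hpow] with k hk
    rw [norm_smul, Real.norm_of_nonneg (by positivity), div_eq_mul_inv, mul_pow, pow_succ]
    calc (r⁻¹ ^ k * r⁻¹) * ‖B ^ k‖ ≤ (r⁻¹ ^ k * r⁻¹) * s ^ k := by gcongr
      _ = _ := by ring
  let F : Matrix (Fin n) (Fin n) ℂ →+ (Fin n → ℝ) :=
    { toFun := fun M i => (M.mulVec (fun j => (x j : ℂ)) i).re
      map_zero' := by ext; simp
      map_add' := fun M N => by ext; simp [Matrix.add_mulVec] }
  have hF : Continuous F := by
    refine continuous_pi fun i => Complex.continuous_re.comp ?_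
    exact (continuous_apply i).comp (Continuous.matrix_mulVec continuous_id continuous_const)
  refine (hsum.map F hF).congr fun k => ?_
  ext i
  have hBk : B ^ k = (A ^ k).map (algebraMap ℝ ℂ) := by
    rw [hB]; exact (map_pow (algebraMap ℝ ℂ).mapMatrix A k).symm
  simp only [F, Function.comp, AddMonoidHom.coe_mk, ZeroHom.coe_mk, hBk, Matrix.smul_mulVec,
    Pi.smul_apply, Complex.smul_re]
  simp [Matrix.mulVec, dotProduct]

end Gelfand

lemma mulVec_re_smul {n : ℕ} (A : Matrix (Fin n) (Fin n) ℝ) {μ : ℂ} {w : Fin n → ℂ}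
    (hw : (A.map (algebraMap ℝ ℂ)).mulVec w = μ • w) (c : ℂ) :
    A.mulVec (fun i => (c * w i).re) = fun i => (c * μ * w i).re := by
  ext i
  have h : (A.map (algebraMap ℝ ℂ)).mulVec (c • w) i = c * μ * w i := by
    rw [Matrix.mulVec_smul, hw]; simp [mul_assoc]
  rw [← h]
  simp [Matrix.mulVec, dotProduct]

/-- A positive vector dominating the unit multiples of an eigenvector `w` keeps dominating its
images under the powers of `A`. -/
lemma pow_mulVec_add_re_mem {n : ℕ} {K : Set (Fin n → ℝ)} {A : Matrix (Fin n) (Fin n) ℝ}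
    (hAK : ∀ x ∈ K, A.mulVec x ∈ K) {μ : ℂ} {w : Fin n → ℂ}
    (hw : (A.map (algebraMap ℝ ℂ)).mulVec w = μ • w) {x : Fin n → ℝ}
    (hx : ∀ c : ℂ, ‖c‖ ≤ 1 → x + (fun i => (c * w i).re) ∈ K) (k : ℕ) :
    ∀ c : ℂ, ‖c‖ ≤ ‖μ‖ ^ k → (A ^ k).mulVec x + (fun i => (c * w i).re) ∈ K := by
  induction k with
  | zero => simpa using hx
  | succ k ih =>
    intro c hc
    have hdiv : c / μ * μ = c ∧ ‖c / μ‖ ≤ ‖μ‖ ^ k := by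
      rcases eq_or_ne μ 0 with rfl | hμ
      · have : c = 0 := by simpa using hc
        simp [this]
      · refine ⟨div_mul_cancel₀ c hμ, ?_⟩
        rw [norm_div, div_le_iff₀ (norm_pos_iff.2 hμ)]
        simpa [pow_succ] using hc
    have h := hAK _ (ih (c / μ) hdiv.2)
    rwa [Matrix.mulVec_add, mulVec_re_smul A hw, hdiv.1, Matrix.mulVec_mulVec, ← pow_succ'] at h

/-- The resolvent of `A` at `r` applied to `x` is a positive vector of norm at least of order
`1 / (r - specRad A)`. -/
lemma exists_resolvent_vector {n : ℕ} (hn : 0 < n) {K : Set (Fin n → ℝ)}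
    (hKclosed : IsClosed K) (hKadd : ∀ x ∈ K, ∀ y ∈ K, x + y ∈ K)
    (hKcone : ∀ c : ℝ, 0 ≤ c → ∀ x ∈ K, c • x ∈ K) {A : Matrix (Fin n) (Fin n) ℝ}
    {x u : Fin n → ℝ} (hxK : ∀ k : ℕ, (A ^ k).mulVec x ∈ K)
    (hxu : ∀ k : ℕ, (A ^ k).mulVec x + specRad A ^ k • u ∈ K) {r : ℝ} (hr : specRad A < r) :
    ∃ y ∈ K, A.mulVec y = r • y - x ∧ (r - specRad A) • y + u ∈ K := by
  have h0 : 0 ≤ specRad A := ENNReal.toReal_nonneg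
  have hr0 : 0 < r := h0.trans_lt hr
  have hK0 : (0 : Fin n → ℝ) ∈ K := by simpa using hKcone 0 le_rfl _ (hxK 0)
  have hsumK : ∀ f : ℕ → Fin n → ℝ, (∀ k, f k ∈ K) → ∀ s, HasSum f s → s ∈ K := by
    intro f hf s hs
    refine hKclosed.mem_of_tendsto hs (Filter.Eventually.of_forall fun t => ?_)
    exact Finset.sum_induction f (· ∈ K) (fun a b ha hb => hKadd a ha b hb) hK0 fun k _ => hf k
  obtain ⟨y, hy⟩ := summable_pow_mulVec_of_specRad_lt hn A hr x
  refine ⟨y, hsumK _ (fun k => hKcone _ (by positivity) _ (hxK k)) _ hy, ?_, ?_⟩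
  · have h1 : HasSum (fun k : ℕ => r⁻¹ ^ (k + 1) • (A ^ (k + 1)).mulVec x) (A.mulVec y) := by
      have := hy.map (Matrix.mulVecLin A) (LinearMap.continuous_of_finiteDimensional _)
      refine this.congr_fun fun k => ?_
      simp [pow_succ']
    have h2 : HasSum (fun k : ℕ => r⁻¹ ^ k • (A ^ k).mulVec x) (r • y) := by
      refine (hy.const_smul r).congr_fun fun k => ?_
      rw [smul_smul, pow_succ', mul_inv_cancel_left₀ hr0.ne']
    have h3 := (hasSum_nat_add_iff' 1).2 h2
    simp only [Finset.range_one, Finset.sum_singleton, pow_zero, one_smul, Matrix.one_mulVec] at h3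
    exact h1.unique h3
  · have hg : HasSum (fun k : ℕ => r⁻¹ ^ (k + 1) * specRad A ^ k) (r - specRad A)⁻¹ := by
      have := (hasSum_geometric_of_lt_one (by positivity) ((div_lt_one hr0).2 hr)).mul_left r⁻¹
      have e : r⁻¹ * (1 - specRad A / r)⁻¹ = (r - specRad A)⁻¹ := by
        rw [← mul_inv, mul_sub, mul_one, mul_div_cancel₀ _ hr0.ne']
      rw [e] at this
      refine this.congr_fun fun k => ?_
      rw [div_eq_mul_inv, mul_pow]; ring
    have h := hsumK _ (fun k => hKcone (r⁻¹ ^ (k + 1)) (by positivity) _ (hxu k))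
      (y + (r - specRad A)⁻¹ • u) ((hy.add (hg.smul_const u)).congr_fun fun k => by
        rw [smul_add, smul_smul])
    have := hKcone (r - specRad A) (sub_nonneg.2 hr.le) _ h
    rwa [smul_add, smul_smul, mul_inv_cancel₀ (sub_pos.2 hr).ne', one_smul] at this

/-- Perron–Frobenius for cone-preserving matrices: if
`K ⊆ ℝ^n` is a closed convex pointed cone with nonempty interior and
`A K ⊆ K`, then `ρ(A)` is an eigenvalue of `A` with an eigenvector in `K`. -/
theorem stmt16 {n : ℕ} (hn : 0 < n) (K : Set (Fin n → ℝ))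
    (hKclosed : IsClosed K) (hKconvex : Convex ℝ K)
    (hKcone : ∀ c : ℝ, 0 ≤ c → ∀ x ∈ K, c • x ∈ K)
    (hKpointed : K ∩ (-K) ⊆ {0})
    (hKint : (interior K).Nonempty)
    (A : Matrix (Fin n) (Fin n) ℝ)
    (hAK : ∀ x ∈ K, A.mulVec x ∈ K) :
    ∃ v ∈ K, v ≠ 0 ∧ A.mulVec v = specRad A • v := by
  have hKadd : ∀ x ∈ K, ∀ y ∈ K, x + y ∈ K := fun x hx y hy => by
    have := hKcone 2 (by norm_num) _
      (hKconvex hx hy (by norm_num : (0 : ℝ) ≤ 1 / 2) (by norm_num : (0 : ℝ) ≤ 1 / 2) (by norm_num))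
    simpa [smul_add, smul_smul] using this
  obtain ⟨μ, w, hw0, hw, hμ⟩ := exists_eigenvector_norm_eq_specRad hn A
  obtain ⟨x, hx⟩ : ∃ x, ∀ c : ℂ, ‖c‖ ≤ 1 → x + (fun i => (c * w i).re) ∈ K := by
    obtain ⟨x₀, hx₀⟩ := hKint
    obtain ⟨ε, hε, hball⟩ := Metric.mem_nhds_iff.1 (mem_interior_iff_mem_nhds.1 hx₀)
    have hM : 0 < ‖w‖ := norm_pos_iff.2 hw0
    set t := 2 * ‖w‖ / ε with ht
    have ht0 : 0 < t := by positivity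
    refine ⟨t • x₀, fun c hc => ?_⟩
    have hmem : x₀ + t⁻¹ • (fun i => (c * w i).re) ∈ K := by
      refine hball ?_
      rw [mem_ball_iff_norm, add_sub_cancel_left, norm_smul, Real.norm_of_nonneg (by positivity)]
      have h1 : ‖fun i => (c * w i).re‖ ≤ ‖w‖ := by
        refine (pi_norm_le_iff_of_nonneg hM.le).2 fun i => ?_
        calc ‖(c * w i).re‖ ≤ ‖c * w i‖ := Complex.abs_re_le_norm _
          _ = ‖c‖ * ‖w i‖ := norm_mul _ _
          _ ≤ 1 * ‖w‖ := by gcongr; exact norm_le_pi_norm w i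
          _ = ‖w‖ := one_mul _
      calc t⁻¹ * ‖fun i => (c * w i).re‖ ≤ t⁻¹ * ‖w‖ := by gcongr
        _ = ε / 2 := by rw [ht]; field_simp
        _ < ε := half_lt_self hε
    have := hKcone t ht0.le _ hmem
    rwa [smul_add, smul_smul, mul_inv_cancel₀ ht0.ne', one_smul] at this
  obtain ⟨c, hc, hcK⟩ : ∃ c : ℂ, ‖c‖ ≤ 1 ∧ (fun i => (c * w i).re) ∉ K := by
    by_contra! h
    have hzero : ∀ c : ℂ, ‖c‖ ≤ 1 → (fun i => (c * w i).re) = 0 := fun c hc => by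
      refine hKpointed ⟨h c hc, ?_⟩
      have := h (-c) (by simpa using hc)
      rw [Set.mem_neg]
      convert this using 1
      ext i
      simp
    refine hw0 (funext fun i => Complex.ext ?_ ?_)
    · simpa using congrFun (hzero 1 (by simp)) i
    · simpa using congrFun (hzero Complex.I (by simp)) i
  set u : Fin n → ℝ := fun i => (c * w i).re with hu
  obtain ⟨δ, hδ, hδK⟩ := Metric.mem_nhds_iff.1 (hKclosed.isOpen_compl.mem_nhds hcK)
  have hpow := pow_mulVec_add_re_mem hAK hw hx
  have hxK : ∀ k : ℕ, (A ^ k).mulVec x ∈ K := fun k => by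
    have := hpow k 0 (by simp)
    simp only [zero_mul, Complex.zero_re] at this
    exact (add_zero ((A ^ k).mulVec x)) ▸ this
  have hxu : ∀ k : ℕ, (A ^ k).mulVec x + specRad A ^ k • u ∈ K := fun k => by
    have := hpow k ((specRad A ^ k : ℝ) * c) (by
      rw [norm_mul, Complex.norm_real, ← hμ, Real.norm_of_nonneg (by positivity)]
      exact mul_le_of_le_one_right (by positivity) hc)
    convert this using 2
    ext i
    simp only [hu, Pi.smul_apply, smul_eq_mul, mul_assoc, Complex.re_ofReal_mul]
  set r : ℕ → ℝ := fun m => specRad A + 1 / ((m : ℝ) + 1) with hr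
  have hrlt : ∀ m, specRad A < r m := fun m => lt_add_of_pos_right _ (by positivity)
  have hrlim : Filter.Tendsto r Filter.atTop (nhds (specRad A)) := by
    simpa [hr] using tendsto_one_div_add_atTop_nhds_zero_nat.const_add (specRad A)
  choose y hyK hyA hyu using fun m =>
    exists_resolvent_vector hn hKclosed hKadd hKcone hxK hxu (hrlt m)
  have hynorm : ∀ m, δ ≤ (r m - specRad A) * ‖y m‖ := fun m => by
    by_contra! h
    refine hδK ?_ (hyu m)
    rw [mem_ball_iff_norm, add_sub_cancel_right, norm_smul,
      Real.norm_of_nonneg (sub_nonneg.2 (hrlt m).le)]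
    exact h
  have hypos : ∀ m, 0 < ‖y m‖ := fun m =>
    pos_of_mul_pos_right (hδ.trans_le (hynorm m)) (sub_nonneg.2 (hrlt m).le)
  set z : ℕ → Fin n → ℝ := fun m => ‖y m‖⁻¹ • y m with hz
  have hzn : ∀ m, z m ∈ Metric.sphere (0 : Fin n → ℝ) 1 := fun m => by
    simp [hz, norm_smul, (hypos m).ne']
  have hzA : ∀ m, A.mulVec (z m) - r m • z m = -(‖y m‖⁻¹ • x) := fun m => by
    simp only [hz, Matrix.mulVec_smul, hyA]
    module
  have hinv : Filter.Tendsto (fun m => ‖y m‖⁻¹) Filter.atTop (nhds 0) := by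
    refine squeeze_zero (g := fun m => (r m - specRad A) / δ) (fun m => by positivity)
      (fun m => ?_) (by simpa using (hrlim.sub_const (specRad A)).div_const δ)
    rw [inv_le_iff_one_le_mul₀ (hypos m), div_mul_eq_mul_div, one_le_div hδ]
    exact hynorm m
  obtain ⟨v, hv, φ, hφ, hlim⟩ := (isCompact_sphere (0 : Fin n → ℝ) 1).tendsto_subseq hzn
  refine ⟨v, hKclosed.mem_of_tendsto hlim (Filter.Eventually.of_forall fun m =>
    hKcone _ (by positivity) _ (hyK _)), ?_, ?_⟩
  · rintro rfl
    simp at hv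
  · have hcont : Continuous fun a : Fin n → ℝ => A.mulVec a :=
      Continuous.matrix_mulVec continuous_const continuous_id
    have h1 : Filter.Tendsto (fun m => A.mulVec (z (φ m)) - r (φ m) • z (φ m)) Filter.atTop
        (nhds (A.mulVec v - specRad A • v)) :=
      ((hcont.tendsto v).comp hlim).sub ((hrlim.comp hφ.tendsto_atTop).smul hlim)
    have h2 : Filter.Tendsto (fun m => A.mulVec (z (φ m)) - r (φ m) • z (φ m)) Filter.atTop
        (nhds 0) := by
      simp only [hzA]
      simpa using ((hinv.comp hφ.tendsto_atTop).smul_const x).neg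
    exact sub_eq_zero.1 (tendsto_nhds_unique h1 h2)
end
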